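/- arXiv:2503.16758 — 5 statements merged into one kernel-verified Lean document; each statement's English description precedes it below -/
import Mathlib

section
/- Let v₁ʳ, v₂ʳ, v₁ˡ, v₂ˡ ∈ ℝ and let F₁ʳ, F₂ʳ, F₁ˡ, F₂ˡ be vectors in EuclideanSpace ℝ (Fin 3). Assume that F₁ʳ and F₂ʳ are linearly independent over ℝ. Then there exists a constant C > 0 such that for all γ, δ, η, η̃ ∈ ℝ one has (η·(v₁ʳ − v₁ˡ) + η̃·(v₂ʳ − v₂ˡ))² + γ² + (δ + η·v₁ʳ + η̃·v₂ʳ)² + ‖η • (F₁ʳ − F₁ˡ) + η̃ • (F₂ʳ − F₂ˡ)‖² + ‖η • F₁ʳ + η̃ • F₂ʳ‖² ≥ C·(γ² + δ² + η² + η̃²). -/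
open scoped RealInnerProductSpace

/-- A finite linearly independent family in a real normed space is bounded below with respect to
the Euclidean norm of the coefficients. -/
theorem LinearIndependent.exists_pos_mul_sum_sq_le_norm_sq {ι E : Type*} [Fintype ι]
    [NormedAddCommGroup E] [NormedSpace ℝ E] {v : ι → E} (hv : LinearIndependent ℝ v) :
    ∃ c > (0 : ℝ), ∀ w : ι → ℝ, c * ∑ i, w i ^ 2 ≤ ‖∑ i, w i • v i‖ ^ 2 := by
  let f : EuclideanSpace ℝ ι →ₗ[ℝ] E :=
    Fintype.linearCombination ℝ v ∘ₗ (WithLp.linearEquiv 2 ℝ (ι → ℝ)).toLinearMap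
  have hf : f.ker = ⊥ := LinearMap.ker_eq_bot.2 <|
    (hv.fintypeLinearCombination_injective).comp (WithLp.linearEquiv 2 ℝ (ι → ℝ)).injective
  obtain ⟨K, hK, hanti⟩ := f.exists_antilipschitzWith hf
  have hK' : (0 : ℝ) < K := hK
  refine ⟨((K : ℝ) ^ 2)⁻¹, by positivity, fun w => ?_⟩
  have hw : ‖WithLp.toLp 2 w‖ ≤ K * ‖∑ i, w i • v i‖ := by
    simpa [f, Fintype.linearCombination_apply] using
      hanti.le_mul_norm_sub (WithLp.toLp 2 w) 0
  have hsq := pow_le_pow_left₀ (norm_nonneg _) hw 2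
  rw [EuclideanSpace.real_norm_sq_eq, mul_pow] at hsq
  exact (inv_mul_le_iff₀ (by positivity)).2 hsq

/-- Ellipticity of the front symbol for the 3D elastic vortex sheet:
under the non-parallel condition (linear independence of the first two rows
of the right deformation gradient), the squared modulus of the front symbol
dominates the full frequency. -/
theorem front_symbol_ellipticity
    (v₁r v₂r v₁l v₂l : ℝ)
    (F₁r F₂r F₁l F₂l : EuclideanSpace ℝ (Fin 3))
    (hindep : LinearIndependent ℝ ![F₁r, F₂r]) :
    ∃ C > (0 : ℝ), ∀ γ δ η η' : ℝ,
      (η * (v₁r - v₁l) + η' * (v₂r - v₂l)) ^ 2 + γ ^ 2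
        + (δ + η * v₁r + η' * v₂r) ^ 2
        + ‖η • (F₁r - F₁l) + η' • (F₂r - F₂l)‖ ^ 2
        + ‖η • F₁r + η' • F₂r‖ ^ 2
      ≥ C * (γ ^ 2 + δ ^ 2 + η ^ 2 + η' ^ 2) := by
  obtain ⟨c, hc, h⟩ := hindep.exists_pos_mul_sum_sq_le_norm_sq
  refine ⟨c / (2 * c + 2 * (v₁r ^ 2 + v₂r ^ 2) + 1), by positivity, fun γ δ η η' => ?_⟩
  have hF : c * (η ^ 2 + η' ^ 2) ≤ ‖η • F₁r + η' • F₂r‖ ^ 2 := by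
    simpa [Fin.sum_univ_two] using h ![η, η']
  set N := ‖η • F₁r + η' • F₂r‖ ^ 2
  set M := v₁r ^ 2 + v₂r ^ 2 with hM
  have hM0 : 0 ≤ M := by positivity
  set D := (δ + η * v₁r + η' * v₂r) ^ 2 with hD
  have hδ : δ ^ 2 ≤ 2 * D + 2 * (M * (η ^ 2 + η' ^ 2)) := by
    nlinarith [sq_nonneg (δ + 2 * (η * v₁r + η' * v₂r)), sq_nonneg (η * v₂r - η' * v₁r)]
  have hlower : c / (2 * c + 2 * M + 1) * (γ ^ 2 + δ ^ 2 + η ^ 2 + η' ^ 2) ≤ γ ^ 2 + D + N := by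
    rw [div_mul_eq_mul_div, div_le_iff₀ (by positivity)]
    have hD0 : 0 ≤ D := sq_nonneg _
    have hN0 : 0 ≤ N := sq_nonneg _
    nlinarith [mul_le_mul_of_nonneg_left hδ hc.le, mul_le_mul_of_nonneg_left hF hM0,
      mul_nonneg hM0 hD0, mul_nonneg hc.le hN0, mul_nonneg hM0 (sq_nonneg γ),
      mul_nonneg hc.le (sq_nonneg γ), sq_nonneg γ]
  linarith [sq_nonneg (η * (v₁r - v₁l) + η' * (v₂r - v₂l)),
    sq_nonneg ‖η • (F₁r - F₁l) + η' • (F₂r - F₂l)‖]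
end

section
/- Let c > 0 and let F₁, F₂ be linearly independent vectors in EuclideanSpace ℝ (Fin 3). Define g(θ) := ‖(cos θ) • F₁ + (sin θ) • F₂‖², P := ‖F₁‖² − ⟪F₁,F₂⟫²/‖F₂‖² (the squared norm of the perpendicular projection Π⊥_{F₂}(F₁)), S := ‖F₁‖² + ‖F₂‖², and G(F₁,F₂) := (1/4) · inf { (1/cos²θ) · (Real.sqrt (g(θ) + c²) − Real.sqrt (g(θ)))² : θ ∈ ℝ, cos θ ≠ 0 }. Then G(F₁,F₂) ≥ (P/4) · c⁴ / ( S · (Real.sqrt (S + c²) + Real.sqrt S)² ). -/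
open scoped RealInnerProductSpace

/-- A unit combination of two vectors has squared norm at most the sum of the squared norms. -/
theorem norm_cos_smul_add_sin_smul_sq_le {E : Type*} [SeminormedAddCommGroup E] [NormedSpace ℝ E]
    (x y : E) (θ : ℝ) :
    ‖Real.cos θ • x + Real.sin θ • y‖ ^ 2 ≤ ‖x‖ ^ 2 + ‖y‖ ^ 2 := by
  have h : ‖Real.cos θ • x + Real.sin θ • y‖ ≤ |Real.cos θ| * ‖x‖ + |Real.sin θ| * ‖y‖ := by
    simpa [norm_smul] using norm_add_le (Real.cos θ • x) (Real.sin θ • y)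
  have hsq : |Real.cos θ| ^ 2 + |Real.sin θ| ^ 2 = 1 := by simp
  calc ‖Real.cos θ • x + Real.sin θ • y‖ ^ 2
      ≤ (|Real.cos θ| * ‖x‖ + |Real.sin θ| * ‖y‖) ^ 2 := by gcongr
    _ ≤ (|Real.cos θ| ^ 2 + |Real.sin θ| ^ 2) * (‖x‖ ^ 2 + ‖y‖ ^ 2) := by
        linarith [sq_nonneg (|Real.cos θ| * ‖y‖ - |Real.sin θ| * ‖x‖)]
    _ = ‖x‖ ^ 2 + ‖y‖ ^ 2 := by rw [hsq, one_mul]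

theorem sqrt_add_sub_sqrt_eq_div {g a : ℝ} (hg : 0 ≤ g) (ha : 0 < a) :
    √(g + a) - √g = a / (√(g + a) + √g) := by
  have hpos : 0 < √(g + a) := Real.sqrt_pos.2 (by linarith)
  rw [eq_div_iff (by positivity)]
  linarith [Real.sq_sqrt hg, Real.sq_sqrt (show 0 ≤ g + a by linarith)]

theorem div_sqrt_add_le_sqrt_add_sub_sqrt {g s a : ℝ} (hg : 0 ≤ g) (hgs : g ≤ s) (ha : 0 < a) :
    a / (√(s + a) + √s) ≤ √(g + a) - √g := by
  rw [sqrt_add_sub_sqrt_eq_div hg ha]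
  have hpos : 0 < √(g + a) := Real.sqrt_pos.2 (by linarith)
  gcongr

/-- Lower bound for the stability quantity `G(F₁,F₂)` of the main theorem:
`G(F₁,F₂) ≥ (P/4) · c⁴ / (S (√(S+c²) + √S)²)`, where `P = ‖Π⊥_{F₂}(F₁)‖²`
and `S = ‖F₁‖² + ‖F₂‖²`. -/
theorem G_lower_bound (c : ℝ) (hc : 0 < c)
    (F₁ F₂ : EuclideanSpace ℝ (Fin 3))
    (hindep : LinearIndependent ℝ ![F₁, F₂]) :
    (1 / 4) * sInf {x : ℝ | ∃ θ : ℝ, Real.cos θ ≠ 0 ∧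
        x = (1 / Real.cos θ ^ 2) *
          (Real.sqrt (‖(Real.cos θ) • F₁ + (Real.sin θ) • F₂‖ ^ 2 + c ^ 2)
            - Real.sqrt (‖(Real.cos θ) • F₁ + (Real.sin θ) • F₂‖ ^ 2)) ^ 2}
      ≥ ((‖F₁‖ ^ 2 - ⟪F₁, F₂⟫ ^ 2 / ‖F₂‖ ^ 2) / 4) * c ^ 4 /
          ((‖F₁‖ ^ 2 + ‖F₂‖ ^ 2) *
            (Real.sqrt ((‖F₁‖ ^ 2 + ‖F₂‖ ^ 2) + c ^ 2)
              + Real.sqrt (‖F₁‖ ^ 2 + ‖F₂‖ ^ 2)) ^ 2) := by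
  have hF₁ : 0 < ‖F₁‖ := norm_pos_iff.2 (by simpa using hindep.ne_zero 0)
  have hP : ‖F₁‖ ^ 2 - ⟪F₁, F₂⟫ ^ 2 / ‖F₂‖ ^ 2 ≤ ‖F₁‖ ^ 2 + ‖F₂‖ ^ 2 := by
    linarith [sq_nonneg ‖F₂‖, show 0 ≤ ⟪F₁, F₂⟫ ^ 2 / ‖F₂‖ ^ 2 by positivity]
  have hS : 0 < ‖F₁‖ ^ 2 + ‖F₂‖ ^ 2 := by positivity
  have hg := norm_cos_smul_add_sin_smul_sq_le F₁ F₂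
  generalize ‖F₁‖ ^ 2 - ⟪F₁, F₂⟫ ^ 2 / ‖F₂‖ ^ 2 = P at hP ⊢
  generalize ‖F₁‖ ^ 2 + ‖F₂‖ ^ 2 = S at hP hS hg ⊢
  have hle : P / S * (c ^ 2 / (√(S + c ^ 2) + √S)) ^ 2 ≤
      sInf {x : ℝ | ∃ θ : ℝ, Real.cos θ ≠ 0 ∧
        x = (1 / Real.cos θ ^ 2) *
          (√(‖Real.cos θ • F₁ + Real.sin θ • F₂‖ ^ 2 + c ^ 2)
            - √(‖Real.cos θ • F₁ + Real.sin θ • F₂‖ ^ 2)) ^ 2} := by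
    refine le_csInf ⟨_, 0, by simp, rfl⟩ ?_
    rintro _ ⟨θ, hθ, rfl⟩
    have hPS : P / S ≤ 1 / Real.cos θ ^ 2 :=
      ((div_le_one hS).2 hP).trans
        ((one_le_div (by positivity)).2 (Real.cos_sq_le_one θ))
    have hdiff := div_sqrt_add_le_sqrt_add_sub_sqrt (sq_nonneg _) (hg θ) (pow_pos hc 2)
    gcongr
  have hpos : 0 < √(S + c ^ 2) + √S := by positivity
  calc P / 4 * c ^ 4 / (S * (√(S + c ^ 2) + √S) ^ 2)
      = 1 / 4 * (P / S * (c ^ 2 / (√(S + c ^ 2) + √S)) ^ 2) := by field_simp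
    _ ≤ _ := by gcongr
end

section
/- Let c > 0, v̄ ∈ ℝ, and let F₁, F₂ be vectors in EuclideanSpace ℝ (Fin 3) with F₂ ≠ 0. Assume the stability condition v̄² < (‖F₁‖² − ⟪F₁,F₂⟫²/‖F₂‖²)/4, i.e. v̄² < ‖Π⊥_{F₂}(F₁)‖²/4. Then for all η, η̃ ∈ ℝ with (η, η̃) ≠ (0, 0), one has the strict inequality 4·v̄²·η² < ‖η • F₁ + η̃ • F₂‖² + c²·(η² + η̃²). -/
open scoped RealInnerProductSpace

/-- Among the vectors `η • x + η' • y` with `η` fixed, the orthogonal projection of `η • x` to the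
complement of `y` has the least norm. -/
theorem sq_mul_perp_le_norm_smul_add_smul_sq {E : Type*} [NormedAddCommGroup E]
    [InnerProductSpace ℝ E] (x : E) {y : E} (hy : y ≠ 0) (η η' : ℝ) :
    η ^ 2 * (‖x‖ ^ 2 - ⟪x, y⟫ ^ 2 / ‖y‖ ^ 2) ≤ ‖η • x + η' • y‖ ^ 2 := by
  have hy' : ‖y‖ ≠ 0 := norm_ne_zero_iff.mpr hy
  have key : ‖η • x + η' • y‖ ^ 2 = η ^ 2 * (‖x‖ ^ 2 - ⟪x, y⟫ ^ 2 / ‖y‖ ^ 2) +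
      (η' * ‖y‖ + η * ⟪x, y⟫ / ‖y‖) ^ 2 := by
    rw [norm_add_sq_real, real_inner_smul_left, real_inner_smul_right, norm_smul, norm_smul,
      mul_pow, mul_pow, Real.norm_eq_abs, Real.norm_eq_abs, sq_abs, sq_abs]
    field_simp
    ring
  rw [key]
  exact le_add_of_nonneg_right (sq_nonneg _)

/-- Separation of frequency strips under the stability condition
`vbar² < ‖Π⊥_{F₂}(F₁)‖²/4`: for all nontrivial tangential frequencies
`(η, η')` one has `4 vbar² η² < ‖η • F₁ + η' • F₂‖² + c² (η² + η'²)`. -/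
theorem strip_separation (c vbar : ℝ) (hc : 0 < c)
    (F₁ F₂ : EuclideanSpace ℝ (Fin 3)) (hF₂ : F₂ ≠ 0)
    (hstab : vbar ^ 2 < (‖F₁‖ ^ 2 - ⟪F₁, F₂⟫ ^ 2 / ‖F₂‖ ^ 2) / 4) :
    ∀ η η' : ℝ, (η, η') ≠ (0, 0) →
      4 * vbar ^ 2 * η ^ 2 < ‖η • F₁ + η' • F₂‖ ^ 2 + c ^ 2 * (η ^ 2 + η' ^ 2) := by
  intro η η' h
  have hpos : 0 < η ^ 2 + η' ^ 2 := by
    by_cases hη : η = 0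
    · have hη' : η' ≠ 0 := fun h' => h (by rw [hη, h'])
      positivity
    · positivity
  have hlower := sq_mul_perp_le_norm_smul_add_smul_sq F₁ hF₂ η η'
  have hspeed := mul_le_mul_of_nonneg_left hstab.le (sq_nonneg η)
  have hsound : 0 < c ^ 2 * (η ^ 2 + η' ^ 2) := mul_pos (pow_pos hc 2) hpos
  linarith
end

section
/- Let ν ∈ ℝ³ with ν ≠ 0, let ψₜ ∈ ℝ, let ρ⁺, ρ⁻ ∈ ℝ with ρ⁺ > 0 and ρ⁻ > 0, let v⁺, v⁻ ∈ ℝ³, let F⁺, F⁻ be real 3 × 3 matrices, and let p : ℝ → ℝ be strictly monotone (increasing) on (0, ∞). Denote by F_j± the j-th column of F± and by ⟪·,·⟫ the Euclidean inner product on ℝ³. Assume: (i) ⟪F_j⁺, ν⟫ = 0 and ⟪F_j⁻, ν⟫ = 0 for j = 1,2,3; (ii) ⟪v⁺, ν⟫ = ψₜ and ⟪v⁻, ν⟫ = ψₜ; (iii) the momentum Rankine–Hugoniot condition ψₜ • (ρ⁺ • v⁺ − ρ⁻ • v⁻) − ( (ρ⁺ · ⟪v⁺,ν⟫) • v⁺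 − (ρ⁻ · ⟪v⁻,ν⟫) • v⁻ ) − (p ρ⁺ − p ρ⁻) • ν + ( ρ⁺ • (F⁺ * (F⁺)ᵀ).mulVec ν − ρ⁻ • (F⁻ * (F⁻)ᵀ).mulVec ν ) = 0. Then ρ⁺ = ρ⁻. Moreover, the mass jump condition ψₜ · (ρ⁺ − ρ⁻) − (ρ⁺ · ⟪v⁺,ν⟫ − ρ⁻ · ⟪v⁻,ν⟫) = 0 holds, and for each j = 1,2,3 the deformation jump condition ψₜ • (ρ⁺ • F_j⁺ − ρ⁻ • F_j⁻) − ( (⟪v⁺,ν⟫ · ρ⁺) • F_j⁺ − (⟪v⁻,ν⟫ · ρ⁻) • F_j⁻ ) + ( (ρ⁺ · ⟪F_j⁺,ν⟫) • v⁺ − (ρ⁻ · ⟪F_j⁻,ν⟫) • v⁻ ) = 0 holds. -/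
open Matrix

/-- If every column of `F` is orthogonal to `ν`, then `F Fᵀ` annihilates `ν`. -/
theorem mul_transpose_mulVec_eq_zero {m n R : Type*} [Fintype m] [Fintype n] [CommSemiring R]
    {F : Matrix m n R} {ν : m → R} (h : ∀ j, (fun i => F i j) ⬝ᵥ ν = 0) :
    (F * Fᵀ).mulVec ν = 0 := by
  have hF : Fᵀ.mulVec ν = 0 := funext h
  rw [← mulVec_mulVec, hF, mulVec_zero]

/-- Reduction of the Rankine–Hugoniot jump conditions at a vortex sheet
(contact discontinuity) for compressible isentropic elastic flow:
under the involution conditions `F_j · ν = 0` and the contact conditions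
`v± · ν = ψₜ`, the momentum jump condition forces `ρ⁺ = ρ⁻`, and the mass
and deformation jump conditions hold. -/
theorem RH_reduction
    (ν : Fin 3 → ℝ) (hν : ν ≠ 0) (ψt : ℝ)
    (ρp ρm : ℝ) (hρp : 0 < ρp) (hρm : 0 < ρm)
    (vp vm : Fin 3 → ℝ)
    (Fp Fm : Matrix (Fin 3) (Fin 3) ℝ)
    (p : ℝ → ℝ) (hp : StrictMonoOn p (Set.Ioi 0))
    (hFp : ∀ j : Fin 3, (fun i => Fp i j) ⬝ᵥ ν = 0)
    (hFm : ∀ j : Fin 3, (fun i => Fm i j) ⬝ᵥ ν = 0)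
    (hvp : vp ⬝ᵥ ν = ψt) (hvm : vm ⬝ᵥ ν = ψt)
    (hmom : ψt • (ρp • vp - ρm • vm)
        - ((ρp * (vp ⬝ᵥ ν)) • vp - (ρm * (vm ⬝ᵥ ν)) • vm)
        - (p ρp - p ρm) • ν
        + (ρp • (Fp * Fpᵀ).mulVec ν - ρm • (Fm * Fmᵀ).mulVec ν) = 0) :
    ρp = ρm ∧
    (ψt * (ρp - ρm) - (ρp * (vp ⬝ᵥ ν) - ρm * (vm ⬝ᵥ ν)) = 0) ∧
    (∀ j : Fin 3,
      ψt • (ρp • (fun i => Fp i j) - ρm • (fun i => Fm i j))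
        - (((vp ⬝ᵥ ν) * ρp) • (fun i => Fp i j) - ((vm ⬝ᵥ ν) * ρm) • (fun i => Fm i j))
        + ((ρp * ((fun i => Fp i j) ⬝ᵥ ν)) • vp - (ρm * ((fun i => Fm i j) ⬝ᵥ ν)) • vm)
        = (0 : Fin 3 → ℝ)) := by
  refine ⟨?_, ?_, fun j => ?_⟩
  · rw [mul_transpose_mulVec_eq_zero hFp, mul_transpose_mulVec_eq_zero hFm, hvp, hvm] at hmom
    have hpν : (p ρp - p ρm) • ν = 0 := by
      rw [← neg_eq_zero, ← hmom]
      module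
    have hpeq : p ρp = p ρm := sub_eq_zero.mp ((smul_eq_zero.mp hpν).resolve_right hν)
    exact hp.injOn hρp hρm hpeq
  · rw [hvp, hvm]
    ring
  · rw [hFp, hFm, hvp, hvm]
    module
end

section
/- Let m, v : ℝ⁴ → ℝ³ be C² functions, where points of ℝ⁴ are written (t, x₁, x₂, x₃), ∂ₜ denotes the partial derivative in the t-direction, and ∂ₖ (k = 1,2,3) denote the partial derivatives in the spatial directions (directional derivatives along the standard basis vectors). Assume that for each i ∈ {1,2,3} and at every point of ℝ⁴, ∂ₜ mᵢ + Σ_{k=1}^{3} ∂ₖ ( mᵢ·vₖ − vᵢ·mₖ ) = 0. Then at every point of ℝ⁴, ∂ₜ ( Σ_{i=1}^{3} ∂ᵢ mᵢ ) = 0. In particular, if the spatial divergence Σ_{i=1}^{3} ∂ᵢ mᵢ vanishes on the slice {t = 0}, then it vanishes identically on ℝ⁴. -/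
section DirectionalDerivatives

variable {E : Type*} [NormedAddCommGroup E] [NormedSpace ℝ E]

theorem ContDiff.differentiable_fderiv_apply_const {f : E → ℝ} (hf : ContDiff ℝ 2 f) (a : E) :
    Differentiable ℝ (fun y => fderiv ℝ f y a) :=
  ((hf.fderiv_right (m := 1) (by norm_num)).clm_apply contDiff_const).differentiable (by norm_num)

theorem ContDiff.fderiv_fderiv_apply_comm {f : E → ℝ} (hf : ContDiff ℝ 2 f) (x a b : E) :
    fderiv ℝ (fun y => fderiv ℝ f y a) x b = fderiv ℝ (fun y => fderiv ℝ f y b) x a := by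
  have hd : DifferentiableAt ℝ (fderiv ℝ f) x :=
    (hf.fderiv_right (m := 1) (by norm_num)).differentiable (by norm_num) x
  have hsymm : IsSymmSndFDerivAt ℝ f x := hf.contDiffAt.isSymmSndFDerivAt (by simp)
  rw [fderiv_clm_apply hd (differentiableAt_const a), fderiv_clm_apply hd (differentiableAt_const b)]
  simpa using hsymm.eq b a

/-- The double divergence of an antisymmetric tensor field vanishes. -/
theorem sum_fderiv_sum_fderiv_eq_zero_of_antisymm {ι : Type*} [Fintype ι] {G : ι → ι → E → ℝ}
    (hG : ∀ i k, ContDiff ℝ 2 (G i k)) (hanti : ∀ i k x, G i k x = -G k i x) (e : ι → E) (x : E) :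
    ∑ i, fderiv ℝ (fun y => ∑ k, fderiv ℝ (G i k) y (e k)) x (e i) = 0 := by
  have hterm (i k : ι) : fderiv ℝ (fun y => fderiv ℝ (G i k) y (e k)) x (e i)
      = -fderiv ℝ (fun y => fderiv ℝ (G k i) y (e i)) x (e k) := by
    have hik : G i k = fun y => -G k i y := funext (hanti i k)
    rw [(hG i k).fderiv_fderiv_apply_comm, hik]
    simp [fderiv_fun_neg]
  have hsum (i : ι) : fderiv ℝ (fun y => ∑ k, fderiv ℝ (G i k) y (e k)) x (e i)
      = ∑ k, fderiv ℝ (fun y => fderiv ℝ (G i k) y (e k)) x (e i) := by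
    rw [fderiv_fun_sum fun k _ => (hG i k).differentiable_fderiv_apply_const (e k) x]
    simp
  simp_rw [hsum]
  have hneg : ∑ i, ∑ k, fderiv ℝ (fun y => fderiv ℝ (G i k) y (e k)) x (e i)
      = -∑ i, ∑ k, fderiv ℝ (fun y => fderiv ℝ (G i k) y (e k)) x (e i) := by
    conv_lhs => rw [Finset.sum_comm]
    simp_rw [← Finset.sum_neg_distrib]
    exact Finset.sum_congr rfl fun k _ => Finset.sum_congr rfl fun i _ => hterm i k
  linarith

theorem Differentiable.apply_add_smul_eq_of_fderiv_apply_eq_zero {f : E → ℝ}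
    (hf : Differentiable ℝ f) {a : E} (ha : ∀ x, fderiv ℝ f x a = 0) (x : E) (s : ℝ) :
    f (x + s • a) = f x := by
  have hline (r : ℝ) : HasDerivAt (fun r : ℝ => x + r • a) a r := by
    simpa using ((hasDerivAt_id r).smul_const a).const_add x
  have hderiv (r : ℝ) : HasDerivAt (fun r : ℝ => f (x + r • a)) 0 r := by
    simpa only [ha, Function.comp_def] using
      (hf (x + r • a)).hasFDerivAt.comp_hasDerivAt r (hline r)
  simpa using is_const_of_deriv_eq_zero (fun r => (hderiv r).differentiableAt)
    (fun r => (hderiv r).deriv) s 0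

end DirectionalDerivatives

/-- Propagation of the involution: if `m` satisfies
`∂ₜ mᵢ + Σₖ ∂ₖ (mᵢ vₖ − vᵢ mₖ) = 0` for each `i`, then the spatial divergence
`Σᵢ ∂ᵢ mᵢ` is independent of time; in particular it vanishes identically
provided it vanishes at `t = 0`.  Here the domain is `ℝ⁴` with coordinates
`(t, x₁, x₂, x₃)`, coordinate `0` is time, and the partial derivatives are
directional derivatives along the standard basis vectors. -/
theorem involution_propagation
    (m v : (Fin 4 → ℝ) → (Fin 3 → ℝ))
    (hm : ContDiff ℝ 2 m) (hv : ContDiff ℝ 2 v)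
    (heq : ∀ i : Fin 3, ∀ x : Fin 4 → ℝ,
      fderiv ℝ (fun y => m y i) x (Pi.single 0 1)
        + ∑ k : Fin 3,
            fderiv ℝ (fun y => m y i * v y k - v y i * m y k) x
              (Pi.single k.succ 1) = 0) :
    (∀ x : Fin 4 → ℝ,
      fderiv ℝ
        (fun y => ∑ i : Fin 3, fderiv ℝ (fun z => m z i) y (Pi.single i.succ 1))
        x (Pi.single 0 1) = 0)
    ∧ ((∀ x : Fin 4 → ℝ, x 0 = 0 →
          ∑ i : Fin 3, fderiv ℝ (fun z => m z i) x (Pi.single i.succ 1) = 0) →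
        ∀ x : Fin 4 → ℝ,
          ∑ i : Fin 3, fderiv ℝ (fun z => m z i) x (Pi.single i.succ 1) = 0) := by
  have hmi (i : Fin 3) : ContDiff ℝ 2 (fun y => m y i) := contDiff_pi.1 hm i
  have hvi (i : Fin 3) : ContDiff ℝ 2 (fun y => v y i) := contDiff_pi.1 hv i
  have htime : ∀ x : Fin 4 → ℝ,
      fderiv ℝ
        (fun y => ∑ i : Fin 3, fderiv ℝ (fun z => m z i) y (Pi.single i.succ 1))
        x (Pi.single 0 1) = 0 := by
    intro x
    have hflux := sum_fderiv_sum_fderiv_eq_zero_of_antisymm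
      (G := fun i k y => m y i * v y k - v y i * m y k)
      (fun i k => ((hmi i).mul (hvi k)).sub ((hvi i).mul (hmi k)))
      (fun i k y => by ring) (fun i => Pi.single i.succ 1) x
    rw [fderiv_fun_sum fun i _ => (hmi i).differentiable_fderiv_apply_const _ x,
      sum_apply, ← neg_eq_zero, ← Finset.sum_neg_distrib, ← hflux]
    refine Finset.sum_congr rfl fun i _ => ?_
    rw [(hmi i).fderiv_fderiv_apply_comm, funext fun y => eq_neg_of_add_eq_zero_left (heq i y)]
    simp only [fderiv_fun_neg, neg_apply, neg_neg]
  refine ⟨htime, fun hzero x => ?_⟩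
  have hdiff : Differentiable ℝ
      (fun y => ∑ i : Fin 3, fderiv ℝ (fun z => m z i) y (Pi.single i.succ 1)) :=
    Differentiable.fun_sum fun i _ => (hmi i).differentiable_fderiv_apply_const _
  rw [← hdiff.apply_add_smul_eq_of_fderiv_apply_eq_zero htime x (-x 0)]
  exact hzero _ (by simp)
end
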